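/- Under the Setup, the Grassmann necklace of W is given in terms of that of V by: I_1^W = I_1^V ∪ {n−3}; I_n^W = I_1^V ∪ {n}; I_{n−1}^W = I_n^V ∪ {n−1}; I_{n−2}^W = I_{n−2}^V ∪ {n−2} if n−2 ∉ I_{n−2}^V, I_{n−2}^W = I_{n−2}^V ∪ {n−1} if n−2 ∈ I_{n−2}^V and n−1 ∉ I_{n−2}^V, and I_{n−2}^W = (I_n^V \ {n−5}) ∪ {n−1, n−2} if both n−2 and n−1 lie in I_{n−2}^V; and for every m with 1 < m < n−2, I_m^W = I_m^V ∪ {n−3} if n−3 ∉ I_m^V, while I_m^W = I_m^V ∪ {n−2} if n−3 ∈ I_m^V. -/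

import Mathlib

open scoped Classical

namespace WLD

/-- A propagator of a Wilson loop diagram on the cyclically ordered vertex set
`ZMod n` (vertex `n` is identified with `0`): an unordered pair of edges, the
edge joining vertex `i` to vertex `i+1` being labelled `i`. -/
abbrev Prp (n : ℕ) := Sym2 (ZMod n)

variable (n : ℕ)

/-- The position of `x` in the linear order `i <_i i+1 <_i ⋯ <_i i-1`. -/
def ord (i x : ZMod n) : ℕ := (x - i).val

/-- The other end of a propagator `p` having an end on the edge `e`. -/
noncomputable def otherEnd (p : Prp n) (e : ZMod n) : ZMod n :=
  if h : e ∈ p then Sym2.Mem.other h else e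

/-- The vertex support `V(p) = {i, i+1, j, j+1}` of the propagator `p = (i,j)`. -/
def supp (p : Prp n) : Finset (ZMod n) :=
  Sym2.lift ⟨fun i j => {i, i + 1, j, j + 1}, fun i j => by
    ext x
    simp only [Finset.mem_insert, Finset.mem_singleton]
    tauto⟩ p

/-- The vertex support `V(Q)` of a set of propagators. -/
def suppSet (Q : Finset (Prp n)) : Finset (ZMod n) := Q.biUnion (supp n)

/-- `Prop(U)`: the propagators of `P` supported on (a vertex of) `U`. -/
noncomputable def propsOn (P : Finset (Prp n)) (U : Finset (ZMod n)) : Finset (Prp n) :=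
  P.filter fun p => (supp n p ∩ U).Nonempty

/-- Two propagators `p = (i,j)` and `q = (k,l)` cross if `i < k < j < l` cyclically. -/
def Crossing (p q : Prp n) : Prop :=
  ∃ i j k l : ZMod n, p = s(i, j) ∧ q = s(k, l) ∧
    0 < ord n i k ∧ ord n i k < ord n i j ∧ ord n i j < ord n i l

/-- Weak admissibility of a Wilson loop diagram. -/
structure IsWeaklyAdmissible (P : Finset (Prp n)) : Prop where
  dense : ∀ Q ⊆ P, Q.Nonempty → Q.card + 3 ≤ (suppSet n Q).card
  noncross : ∀ p ∈ P, ∀ q ∈ P, ¬ Crossing n p q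

/-- Admissibility of a Wilson loop diagram. -/
structure IsAdmissible (P : Finset (Prp n)) : Prop where
  card_add_four_le : P.card + 4 ≤ n
  dense : ∀ Q ⊆ P, Q.Nonempty → Q.card + 3 ≤ (suppSet n Q).card
  noncross : ∀ p ∈ P, ∀ q ∈ P, ¬ Crossing n p q

/-- The length of a propagator `p = (i,j)`:
`min(|[i+1, j]|, |[j+1, i]|)`, the number of vertices on its smaller side. -/
def plength (p : Prp n) : ℕ :=
  Sym2.lift ⟨fun i j => min ((j - i - 1).val + 1) ((i - j - 1).val + 1),
    fun _ _ => min_comm _ _⟩ p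

/-- `InsideDir n i p q` : the propagator `q = (k,l)` lies (weakly) inside the
propagator `p = (i,j)` directed from its end `i`, i.e. `i ≤_i k <_i l ≤_i j`. -/
def InsideDir (i : ZMod n) (p q : Prp n) : Prop :=
  ∃ j k l : ZMod n, p = s(i, j) ∧ q = s(k, l) ∧
    ord n i k < ord n i l ∧ ord n i l ≤ ord n i j

/-- Sorting key measuring how far clockwise of the vertex `a` the relevant end of
a propagator supported on `a` is attached: ends on the edge `a-1` are clockwise of
ends on the edge `a`, and on a fixed edge an end is the more clockwise the larger
the propagator is (nestedness of noncrossing propagators sharing an edge). -/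
noncomputable def cwKey (a : ZMod n) (p : Prp n) : ℕ :=
  if a - 1 ∈ p then n + ord n (a - 1) (otherEnd n p (a - 1))
  else ord n a (otherEnd n p a)

/-- The clockwise-most propagator of `S` supported on the vertex `a`, if any. -/
noncomputable def pickCW (S : Finset (Prp n)) (a : ZMod n) : Option (Prp n) :=
  if h : (S.filter fun p => a ∈ supp n p).Nonempty then
    some (Classical.choose
      ((S.filter fun p => a ∈ supp n p).exists_max_image (cwKey n a) h))
  else none

/-- The Grassmann necklace algorithm started at the vertex `i`: after `t` steps,
`(gnRun n P i t).1` is the set of propagators not yet deleted, and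
`(gnRun n P i t).2` records the vertex assigned to each deleted propagator.
Step `t+1` processes the vertex `i + t`: if some not-yet-deleted propagator is
supported on it, the clockwise-most such propagator is deleted and assigned
that vertex. -/
noncomputable def gnRun (P : Finset (Prp n)) (i : ZMod n) :
    ℕ → Finset (Prp n) × (Prp n → Option (ZMod n))
  | 0 => (P, fun _ => none)
  | t + 1 =>
    match pickCW n (gnRun P i t).1 (i + (t : ZMod n)) with
    | none => gnRun P i t
    | some p => ((gnRun P i t).1.erase p,
        Function.update (gnRun P i t).2 p (some (i + (t : ZMod n))))

/-- `I_i^W(p)`: the vertex contributed by the propagator `p` to the Grassmann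
necklace term `I_i^W` (as an `Option`; the algorithm makes one full circuit of
the vertex set, i.e. runs for `n` steps). -/
noncomputable def gnAssign (P : Finset (Prp n)) (i : ZMod n) (p : Prp n) :
    Option (ZMod n) :=
  (gnRun n P i n).2 p

/-- The Grassmann necklace term `I_i^W` produced by the algorithm. -/
noncomputable def gnSet [NeZero n] (P : Finset (Prp n)) (i : ZMod n) :
    Finset (ZMod n) :=
  Finset.univ.filter fun v => ∃ p, gnAssign n P i p = some v

/-- The cyclic interval `{a, a+1, …, a + (len-1)}` in `ZMod n`. -/
def cInterval [NeZero n] (a : ZMod n) (len : ℕ) : Finset (ZMod n) :=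
  Finset.univ.filter fun x => ord n a x < len

/-- A Grassmann necklace of type `(k, n)`: a cyclic sequence of `k`-element
subsets of the vertex set such that `I_{i+1} = (I_i \ {i}) ∪ {j}` for some `j`
whenever `i ∈ I_i`, and `I_{i+1} = I_i` otherwise. -/
def IsGrassmannNecklace [NeZero n] (k : ℕ) (I : ZMod n → Finset (ZMod n)) : Prop :=
  (∀ i, (I i).card = k) ∧
  ∀ i : ZMod n,
    (i ∈ I i → ∃ j : ZMod n, I (i + 1) = insert j ((I i).erase i)) ∧
    (i ∉ I i → I (i + 1) = I i)

/-- Independence in the matroid `M(W)`: no subset `U` of `J` supports fewer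
propagators than the vertices it contains. -/
def Indep (P : Finset (Prp n)) (J : Finset (ZMod n)) : Prop :=
  ∀ U ⊆ J, U.card ≤ (propsOn n P U).card

/-- `A` is lexicographically smaller than `B` with respect to the order `<_i`:
the `<_i`-least element of the symmetric difference lies in `A`. -/
def LexLt (i : ZMod n) (A B : Finset (ZMod n)) : Prop :=
  ∃ v, v ∈ A ∧ v ∉ B ∧ ∀ w, ord n i w < ord n i v → (w ∈ A ↔ w ∈ B)

/-- A `+` is placed in the box `(a, b)` of the Le diagram with row labels `I₁`
by the necklace term `Ii`: writing `I₁ \ Ii = {a₁ > ⋯ > a_r}` and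
`Ii \ I₁ = {b₁ < ⋯ < b_r}` in the `<₁` order, the plusses are in the boxes
`(a_t, b_t)`. -/
def LePlusAt (I₁ Ii : Finset (ZMod n)) (a b : ZMod n) : Prop :=
  a ∈ I₁ \ Ii ∧ b ∈ Ii \ I₁ ∧
    ((I₁ \ Ii).filter fun x => ord n 1 a < ord n 1 x).card =
      ((Ii \ I₁).filter fun y => ord n 1 y < ord n 1 b).card

/-- The box `(a, b)` of the Le diagram of the diagram `P` contains a `+`. -/
def LePlus [NeZero n] (P : Finset (Prp n)) (a b : ZMod n) : Prop :=
  ∃ i : ZMod n, LePlusAt n (gnSet n P 1) (gnSet n P i) a b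

/-- The number of `+` entries in the Le diagram of the diagram `P`. -/
noncomputable def plusCount [NeZero n] (P : Finset (Prp n)) : ℕ :=
  (Finset.univ.filter fun ab : ZMod n × ZMod n => LePlus n P ab.1 ab.2).card

/-- The length of the row labelled `a` of the Young diagram with row labels `I₁`
(the boxes of row `a` are indexed by the column labels `b ∉ I₁` with `a <₁ b`). -/
noncomputable def rowLen [NeZero n] (I₁ : Finset (ZMod n)) (a : ZMod n) : ℕ :=
  (Finset.univ.filter fun b => b ∉ I₁ ∧ ord n 1 a < ord n 1 b).card

/-- The entry of the matrix `C(W)` in row `p` and column `q`: the indeterminate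
`x_{p,q}` if `q ∈ V(p)`, and `0` otherwise. -/
noncomputable def CW (p : Prp n) (q : ZMod n) : MvPolynomial (Prp n × ZMod n) ℝ :=
  if q ∈ supp n p then MvPolynomial.X (p, q) else 0

/-- The column paired with the row `p` in the minors determined by `I_i^W`. -/
noncomputable def colOf (P : Finset (Prp n)) (i : ZMod n) (p : Prp n) : ZMod n :=
  (gnAssign n P i p).getD i

/-- `Δ_{I_i}`: the determinant of the `k × k` minor of `C(W)` on the columns
indexed by `I_i^W`, rows and columns paired via the necklace assignment. -/
noncomputable def Delta (P : Finset (Prp n)) (i : ZMod n) :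
    MvPolynomial (Prp n × ZMod n) ℝ :=
  Matrix.det (Matrix.of fun p q : ↥P => CW n (p : Prp n) (colOf n P i (q : Prp n)))

/-- `S_i`: the propagators whose contribution changes from `I_{i-1}` to `I_i`. -/
noncomputable def Schanged (P : Finset (Prp n)) (i : ZMod n) : Finset (Prp n) :=
  P.filter fun p => gnAssign n P (i - 1) p ≠ gnAssign n P i p

/-- `r_i`: the determinant of the minor of `C(W)` with rows indexed by `S_i` and
columns indexed by `I_i(S_i)` (equal to `1` when `S_i = ∅`). -/
noncomputable def rfac (P : Finset (Prp n)) (i : ZMod n) :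
    MvPolynomial (Prp n × ZMod n) ℝ :=
  Matrix.det
    (Matrix.of fun p q : ↥(Schanged n P i) => CW n (p : Prp n) (colOf n P i (q : Prp n)))

/-- `R = ∏ᵢ rᵢ`, the polynomial produced by the algorithm. -/
noncomputable def Rpoly [NeZero n] (P : Finset (Prp n)) :
    MvPolynomial (Prp n × ZMod n) ℝ :=
  ∏ i : ZMod n, rfac n P i

/-- Position of the end of the propagator `p` along the edge `e`: larger values
attach closer to the vertex `e`, i.e. earlier in the counterclockwise ordering
of the ends of propagators along the edge `e`. -/
noncomputable def edgeKey (e : ZMod n) (p : Prp n) : ℕ := ord n e (otherEnd n p e)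

/-- The propagators of `P` with an end on the edge `e`. -/
noncomputable def onEdge (P : Finset (Prp n)) (e : ZMod n) : Finset (Prp n) :=
  P.filter fun p => e ∈ p

/-- `p` is the first propagator (`p₁`) on the edge `e` in the counterclockwise
ordering of the propagators with an end on the edge `e`. -/
def IsCcwFirst (P : Finset (Prp n)) (e : ZMod n) (p : Prp n) : Prop :=
  p ∈ onEdge n P e ∧ ∀ q ∈ onEdge n P e, edgeKey n e q ≤ edgeKey n e p

/-- `p` is the last propagator (`p_r`) on the edge `e` in the counterclockwise
ordering of the propagators with an end on the edge `e`. -/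
def IsCcwLast (P : Finset (Prp n)) (e : ZMod n) (p : Prp n) : Prop :=
  p ∈ onEdge n P e ∧ ∀ q ∈ onEdge n P e, edgeKey n e p ≤ edgeKey n e q

/-- `p` and `q` are consecutive, in this order (`p = p_j`, `q = p_{j+1}`), in the
counterclockwise ordering of the propagators with an end on the edge `e`. -/
def ConsecOnEdge (P : Finset (Prp n)) (e : ZMod n) (p q : Prp n) : Prop :=
  p ∈ onEdge n P e ∧ q ∈ onEdge n P e ∧ edgeKey n e q < edgeKey n e p ∧
    ∀ r ∈ onEdge n P e, ¬ (edgeKey n e q < edgeKey n e r ∧ edgeKey n e r < edgeKey n e p)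

/-- The factor `R_e` of the denominator `R(W)` associated to the edge `e`:
`R_e = x_{p₁,e+1} • ∏_{j=1}^{r-1} (x_{p_j,e} x_{p_{j+1},e+1} - x_{p_{j+1},e} x_{p_j,e+1}) • x_{p_r,e}`
for the counterclockwise ordering `p₁, …, p_r` of the propagators on the edge `e`
(`R_e = 1` if there are none). -/
noncomputable def Redge (P : Finset (Prp n)) (e : ZMod n) :
    MvPolynomial (Prp n × ZMod n) ℝ :=
  (∏ p ∈ (onEdge n P e).filter (IsCcwFirst n P e), MvPolynomial.X (p, e + 1)) *
    (∏ pq ∈ (P ×ˢ P).filter (fun pq => ConsecOnEdge n P e pq.1 pq.2),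
      (MvPolynomial.X (pq.1, e) * MvPolynomial.X (pq.2, e + 1) -
        MvPolynomial.X (pq.2, e) * MvPolynomial.X (pq.1, e + 1))) *
    (∏ p ∈ (onEdge n P e).filter (IsCcwLast n P e), MvPolynomial.X (p, e))

/-- The denominator `R(W) = ∏ₑ R_e` of the integrand `Ω(W)`. -/
noncomputable def RW [NeZero n] (P : Finset (Prp n)) :
    MvPolynomial (Prp n × ZMod n) ℝ :=
  ∏ e : ZMod n, Redge n P e

/-- The relabelling map associated to the removal of the vertex `i` from the
vertex set `ZMod n`: the vertex of `ZMod (n-1)` in position `t` (in the `<₁`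
order) is sent to the vertex of `ZMod n` in position `t` if `t` precedes the
position of `i`, and to the vertex in position `t+1` otherwise. -/
noncomputable def liftVert (i : ZMod n) (x : ZMod (n - 1)) : ZMod n :=
  1 + ((if ord (n - 1) 1 x < ord n 1 i then ord (n - 1) 1 x
        else ord (n - 1) 1 x + 1 : ℕ) : ZMod n)

end WLD
namespace WLD

/-- The diagram `V` of the Setup: the diagram `W` with the length-2 propagator
`p = (n-3, n-1)` removed. -/
noncomputable def eraseP (n : ℕ) (P : Finset (Prp n)) : Finset (Prp n) :=
  P.erase (s(-3, -1) : Prp n)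

section Positions

variable {n : ℕ}

lemma ord_eq_of_eq_add {i x : ZMod n} {k : ℕ} (hk : k < n) (h : x = i + (k : ZMod n)) :
    ord n i x = k := by
  simp [ord, h, ZMod.val_cast_of_lt hk]

lemma ord_sub_natCast (i : ZMod n) {k : ℕ} (hk : 0 < k) (hkn : k ≤ n) :
    ord n i (i - (k : ZMod n)) = n - k := by
  refine ord_eq_of_eq_add (by omega) ?_
  rw [Nat.cast_sub hkn, ZMod.natCast_self]
  ring

variable [NeZero n]

lemma ord_lt (i x : ZMod n) : ord n i x < n := ZMod.val_lt _

lemma add_ord (i x : ZMod n) : i + (ord n i x : ZMod n) = x := by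
  simp [ord]

lemma ord_injective (i : ZMod n) : Function.Injective (ord n i) := fun x y h => by
  rw [← add_ord i x, ← add_ord i y, h]

lemma eq_of_ord_add_eq {i x : ZMod n} {k : ℕ} (hk : k ≤ n) (h : ord n i x + k = n) :
    x = i - (k : ZMod n) := by
  rw [← add_ord i x, show ord n i x = n - k by omega, Nat.cast_sub hk, ZMod.natCast_self]
  ring

lemma ord_sub_one_of_ne {v x : ZMod n} (h : x ≠ v - 1) :
    ord n (v - 1) x = ord n v x + 1 := by
  have hlt := ord_lt v x
  have hne : ord n v x + 1 ≠ n := fun h' =>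
    h (by simpa using eq_of_ord_add_eq (k := 1) (by omega) h')
  refine ord_eq_of_eq_add (by omega) ?_
  rw [Nat.cast_add, Nat.cast_one, ← add_assoc, add_right_comm, sub_add_cancel, add_ord]

lemma ord_add_one_lt_of_ne {v x : ZMod n} (h : x ≠ v - 1) : ord n v x + 1 < n := by
  rw [← ord_sub_one_of_ne h]
  exact ord_lt _ _

lemma ord_add_one_of_ne {v x : ZMod n} (h : x ≠ v) :
    ord n v x = ord n (v + 1) x + 1 := by
  have h' := ord_sub_one_of_ne (v := v + 1) (x := x) (by rwa [add_sub_cancel_right])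
  rwa [add_sub_cancel_right] at h'

end Positions

section Propagators

variable {n : ℕ}

lemma mem_supp {p : Prp n} {a : ZMod n} : a ∈ supp n p ↔ a ∈ p ∨ a - 1 ∈ p := by
  induction p using Sym2.ind with
  | _ i j =>
    simp only [supp, Sym2.lift_mk, Finset.mem_insert, Finset.mem_singleton, Sym2.mem_iff,
      sub_eq_iff_eq_add]
    tauto

lemma mk_otherEnd {p : Prp n} {e : ZMod n} (h : e ∈ p) : s(e, otherEnd n p e) = p := by
  rw [otherEnd, dif_pos h]
  exact Sym2.other_spec h

lemma otherEnd_mk (a b : ZMod n) : otherEnd n s(a, b) a = b :=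
  Sym2.congr_right.1 (mk_otherEnd (Sym2.mem_mk_left a b))

lemma cwKey_of_sub_one_mem {a : ZMod n} {p : Prp n} (h : a - 1 ∈ p) :
    cwKey n a p = n + ord n (a - 1) (otherEnd n p (a - 1)) := if_pos h

lemma cwKey_of_sub_one_notMem {a : ZMod n} {p : Prp n} (h : a - 1 ∉ p) :
    cwKey n a p = ord n a (otherEnd n p a) := if_neg h

lemma cwKey_lt_iff [NeZero n] {a : ZMod n} {p : Prp n} : cwKey n a p < n ↔ a - 1 ∉ p := by
  by_cases h : a - 1 ∈ p
  · simp [cwKey_of_sub_one_mem h, h]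
  · simp [cwKey_of_sub_one_notMem h, h, ord_lt]

lemma cwKey_injOn [NeZero n] {a : ZMod n} {p q : Prp n} (hp : a ∈ supp n p)
    (hq : a ∈ supp n q) (h : cwKey n a p = cwKey n a q) : p = q := by
  have hiff : a - 1 ∈ p ↔ a - 1 ∈ q := by
    rw [← not_iff_not, ← cwKey_lt_iff, ← cwKey_lt_iff, h]
  by_cases h1 : a - 1 ∈ p
  · have h2 := hiff.1 h1
    rw [cwKey_of_sub_one_mem h1, cwKey_of_sub_one_mem h2, Nat.add_left_cancel_iff] at h
    rw [← mk_otherEnd h1, ← mk_otherEnd h2, ord_injective _ h]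
  · have h2 := fun h => h1 (hiff.2 h)
    rw [cwKey_of_sub_one_notMem h1, cwKey_of_sub_one_notMem h2] at h
    rw [← mk_otherEnd ((mem_supp.1 hp).resolve_right h1),
      ← mk_otherEnd ((mem_supp.1 hq).resolve_right h2), ord_injective _ h]

lemma pickCW_eq_none_iff {S : Finset (Prp n)} {a : ZMod n} :
    pickCW n S a = none ↔ ∀ r ∈ S, a ∉ supp n r := by
  unfold pickCW
  split_ifs with h
  · obtain ⟨r, hr⟩ := h
    rw [Finset.mem_filter] at hr
    simp only [false_iff, not_forall, not_not]
    exact ⟨r, hr.1, hr.2⟩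
  · simpa [Finset.not_nonempty_iff_eq_empty, Finset.filter_eq_empty_iff] using h

lemma pickCW_eq_some {S : Finset (Prp n)} {a : ZMod n} {x : Prp n} (h : pickCW n S a = some x) :
    x ∈ S ∧ a ∈ supp n x ∧ ∀ r ∈ S, a ∈ supp n r → cwKey n a r ≤ cwKey n a x := by
  unfold pickCW at h
  split_ifs at h with hne
  have hs := Classical.choose_spec
    ((S.filter fun p => a ∈ supp n p).exists_max_image (cwKey n a) hne)
  rw [Option.some.inj h, Finset.mem_filter] at hs
  exact ⟨hs.1.1, hs.1.2, fun r hr ha => hs.2 r (Finset.mem_filter.2 ⟨hr, ha⟩)⟩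

lemma pickCW_eq_some_iff [NeZero n] {S : Finset (Prp n)} {a : ZMod n} {x : Prp n} :
    pickCW n S a = some x ↔
      x ∈ S ∧ a ∈ supp n x ∧ ∀ r ∈ S, a ∈ supp n r → cwKey n a r ≤ cwKey n a x := by
  refine ⟨pickCW_eq_some, fun ⟨hx, ha, hmax⟩ => ?_⟩
  cases hy : pickCW n S a with
  | none => exact absurd ha (pickCW_eq_none_iff.1 hy x hx)
  | some y =>
    obtain ⟨hy1, hy2, hy3⟩ := pickCW_eq_some hy
    rw [cwKey_injOn hy2 ha (le_antisymm (hmax y hy1 hy2) (hy3 x hx ha))]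

lemma pickCW_insert_of_notMem_supp [NeZero n] {S : Finset (Prp n)} {a : ZMod n} {p : Prp n}
    (hp : a ∉ supp n p) : pickCW n (insert p S) a = pickCW n S a := by
  cases h : pickCW n S a with
  | none =>
    rw [pickCW_eq_none_iff] at h ⊢
    simpa [hp] using h
  | some x =>
    rw [pickCW_eq_some_iff] at h ⊢
    refine ⟨Finset.mem_insert_of_mem h.1, h.2.1, fun r hr ha => ?_⟩
    rcases Finset.mem_insert.1 hr with rfl | hr
    · exact absurd ha hp
    · exact h.2.2 r hr ha

lemma pickCW_insert_of_lt [NeZero n] {S : Finset (Prp n)} {a : ZMod n} {p z : Prp n}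
    (hz : z ∈ S) (hza : a ∈ supp n z) (hlt : cwKey n a p < cwKey n a z) :
    pickCW n (insert p S) a = pickCW n S a := by
  cases h : pickCW n S a with
  | none => exact absurd hza (pickCW_eq_none_iff.1 h z hz)
  | some x =>
    rw [pickCW_eq_some_iff] at h ⊢
    refine ⟨Finset.mem_insert_of_mem h.1, h.2.1, fun r hr ha => ?_⟩
    rcases Finset.mem_insert.1 hr with rfl | hr
    · exact hlt.le.trans (h.2.2 z hz hza)
    · exact h.2.2 r hr ha

end Propagators

section Algorithm

variable {n : ℕ}

/-- The propagators of `S` left after the vertex `a` has been processed. -/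
noncomputable def stepCW (S : Finset (Prp n)) (a : ZMod n) : Finset (Prp n) :=
  (pickCW n S a).elim S S.erase

/-- The propagators left after `t` steps of the algorithm started at `i`. -/
noncomputable def remaining (P : Finset (Prp n)) (i : ZMod n) : ℕ → Finset (Prp n)
  | 0 => P
  | t + 1 => stepCW (remaining P i t) (i + (t : ZMod n))

lemma stepCW_of_none {S : Finset (Prp n)} {a : ZMod n} (h : pickCW n S a = none) :
    stepCW S a = S := by simp [stepCW, h]

lemma stepCW_of_some {S : Finset (Prp n)} {a : ZMod n} {x : Prp n}
    (h : pickCW n S a = some x) : stepCW S a = S.erase x := by simp [stepCW, h]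

lemma stepCW_subset (S : Finset (Prp n)) (a : ZMod n) : stepCW S a ⊆ S := by
  cases h : pickCW n S a with
  | none => rw [stepCW_of_none h]
  | some x => rw [stepCW_of_some h]; exact Finset.erase_subset _ _

lemma card_le_card_stepCW_add_one (S : Finset (Prp n)) (a : ZMod n) :
    S.card ≤ (stepCW S a).card + 1 := by
  cases h : pickCW n S a with
  | none => rw [stepCW_of_none h]; omega
  | some x => rw [stepCW_of_some h]; exact Nat.le_add_of_sub_le Finset.pred_card_le_card_erase

lemma remaining_succ (P : Finset (Prp n)) (i : ZMod n) (t : ℕ) :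
    remaining P i (t + 1) = stepCW (remaining P i t) (i + (t : ZMod n)) := rfl

lemma remaining_succ' (P : Finset (Prp n)) (i : ZMod n) (t : ℕ) :
    remaining P i (t + 1) = remaining (stepCW P i) (i + 1) t := by
  induction t with
  | zero => simp [remaining]
  | succ t ih =>
    rw [remaining_succ, ih, remaining_succ, Nat.cast_add, Nat.cast_one, add_comm (t : ZMod n) 1,
      add_assoc]

lemma remaining_subset (P : Finset (Prp n)) (i : ZMod n) (t : ℕ) : remaining P i t ⊆ P := by
  induction t with
  | zero => exact subset_rfl
  | succ t ih => exact (stepCW_subset _ _).trans ih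

lemma gnRun_fst (P : Finset (Prp n)) (i : ZMod n) (t : ℕ) :
    (gnRun n P i t).1 = remaining P i t := by
  induction t with
  | zero => rfl
  | succ t ih =>
    rw [remaining_succ, ← ih]
    cases h : pickCW n (gnRun n P i t).1 (i + (t : ZMod n)) with
    | none => rw [stepCW_of_none h, gnRun, h]
    | some x => rw [stepCW_of_some h, gnRun, h]

lemma gnRun_snd_eq_none (P : Finset (Prp n)) (i : ZMod n) (t : ℕ) {p : Prp n}
    (hp : p ∈ remaining P i t) : (gnRun n P i t).2 p = none := by
  induction t with
  | zero => rfl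
  | succ t ih =>
    rw [remaining_succ] at hp
    have h0 := ih (stepCW_subset _ _ hp)
    cases h : pickCW n (remaining P i t) (i + (t : ZMod n)) with
    | none => rw [gnRun, gnRun_fst, h]; exact h0
    | some x =>
      rw [stepCW_of_some h] at hp
      rw [gnRun, gnRun_fst, h]
      simpa [Function.update_of_ne (Finset.ne_of_mem_erase hp)] using h0

lemma exists_gnRun_snd_eq_some_iff (P : Finset (Prp n)) (i v : ZMod n) (t : ℕ) :
    (∃ p, (gnRun n P i t).2 p = some v) ↔
      ∃ s < t, i + (s : ZMod n) = v ∧ ∃ r ∈ remaining P i s, v ∈ supp n r := by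
  induction t with
  | zero => simp [gnRun]
  | succ t ih =>
    simp only [Nat.lt_succ_iff_lt_or_eq, or_and_right, exists_or, exists_eq_left, ← ih]
    cases h : pickCW n (remaining P i t) (i + (t : ZMod n)) with
    | none =>
      rw [gnRun, gnRun_fst, h]
      refine ⟨Or.inl, fun h' => h'.resolve_right ?_⟩
      rintro ⟨rfl, r, hr, hv⟩
      exact pickCW_eq_none_iff.1 h r hr hv
    | some x =>
      obtain ⟨hx, hxa, -⟩ := pickCW_eq_some h
      have hnone := gnRun_snd_eq_none P i t hx
      rw [gnRun, gnRun_fst, h]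
      constructor
      · rintro ⟨p, hp⟩
        by_cases hpx : p = x
        · subst hpx
          simp only [Function.update_self, Option.some.injEq] at hp
          subst hp
          exact Or.inr ⟨rfl, p, hx, hxa⟩
        · exact Or.inl ⟨p, by simpa [Function.update_of_ne hpx] using hp⟩
      · rintro (⟨p, hp⟩ | ⟨rfl, -⟩)
        · have hpx : p ≠ x := by rintro rfl; simp [hnone] at hp
          exact ⟨p, by simpa [Function.update_of_ne hpx] using hp⟩
        · exact ⟨x, by simp⟩

lemma remaining_insert {S : Finset (Prp n)} {p : Prp n} (hp : p ∉ S) {i : ZMod n} {T : ℕ}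
    (h : ∀ s < T, pickCW n (insert p (remaining S i s)) (i + (s : ZMod n)) =
      pickCW n (remaining S i s) (i + (s : ZMod n))) {t : ℕ} (ht : t ≤ T) :
    remaining (insert p S) i t = insert p (remaining S i t) := by
  induction t with
  | zero => rfl
  | succ t ih =>
    rw [remaining_succ, remaining_succ, ih (by omega)]
    have hpick := h t (by omega)
    cases hc : pickCW n (remaining S i t) (i + (t : ZMod n)) with
    | none => rw [stepCW_of_none hc, stepCW_of_none (hpick.trans hc)]
    | some x =>
      rw [stepCW_of_some hc, stepCW_of_some (hpick.trans hc), Finset.erase_insert_of_ne]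
      rintro rfl
      exact hp (remaining_subset _ _ _ (pickCW_eq_some hc).1)

variable [NeZero n]

lemma mem_gnSet {P : Finset (Prp n)} {i v : ZMod n} :
    v ∈ gnSet n P i ↔ ∃ r ∈ remaining P i (ord n i v), v ∈ supp n r := by
  simp only [gnSet, gnAssign, Finset.mem_filter, Finset.mem_univ, true_and,
    exists_gnRun_snd_eq_some_iff]
  constructor
  · rintro ⟨s, hs, hv, h⟩
    rwa [ord_eq_of_eq_add hs hv.symm]
  · exact fun h => ⟨_, ord_lt i v, add_ord i v, h⟩

/-- The propagator deleted first may be removed from the diagram beforehand. -/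
lemma gnSet_of_pickCW_eq_some {P : Finset (Prp n)} {i : ZMod n} {p : Prp n}
    (h : pickCW n P i = some p) :
    gnSet n P i = insert i (gnSet n (P.erase p) (i + 1)) := by
  obtain ⟨hp, hpi, -⟩ := pickCW_eq_some h
  ext v
  rw [Finset.mem_insert, mem_gnSet, mem_gnSet]
  by_cases hv : v = i
  · subst hv
    have h0 : ord n v v = 0 := by simp [ord]
    simp only [true_or, iff_true, h0]
    exact ⟨p, hp, hpi⟩
  · rw [ord_add_one_of_ne hv, remaining_succ', stepCW_of_some h]
    simp [hv]

/-- If the propagator `p` does not affect the run before step `T`, and at step `T` it is the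
only propagator supported on the current vertex, then `p` contributes exactly this vertex. -/
lemma gnSet_insert {S : Finset (Prp n)} {p : Prp n} (hp : p ∉ S) {i : ZMod n} {T : ℕ}
    (hT : T < n)
    (h : ∀ s < T, pickCW n (insert p (remaining S i s)) (i + (s : ZMod n)) =
      pickCW n (remaining S i s) (i + (s : ZMod n)))
    (hpT : i + (T : ZMod n) ∈ supp n p)
    (hST : ∀ r ∈ remaining S i T, i + (T : ZMod n) ∉ supp n r) :
    gnSet n (insert p S) i = insert (i + (T : ZMod n)) (gnSet n S i) := by
  have hpick : pickCW n (insert p (remaining S i T)) (i + (T : ZMod n)) = some p := by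
    refine pickCW_eq_some_iff.2 ⟨Finset.mem_insert_self _ _, hpT, fun r hr ha => ?_⟩
    rcases Finset.mem_insert.1 hr with rfl | hr
    · exact le_rfl
    · exact absurd ha (hST r hr)
  have hsucc : remaining (insert p S) i (T + 1) = remaining S i (T + 1) := by
    rw [remaining_succ, remaining_succ, remaining_insert hp h le_rfl, stepCW_of_some hpick,
      stepCW_of_none (pickCW_eq_none_iff.2 hST),
      Finset.erase_insert fun h' => hp (remaining_subset _ _ _ h')]
  have hafter : ∀ d, remaining (insert p S) i (T + 1 + d) = remaining S i (T + 1 + d) := by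
    intro d
    induction d with
    | zero => exact hsucc
    | succ d ih => rw [← add_assoc, remaining_succ, remaining_succ, ih]
  ext v
  rw [Finset.mem_insert, mem_gnSet, mem_gnSet]
  rcases lt_trichotomy (ord n i v) T with hlt | heq | hgt
  · have hne : v ≠ i + (T : ZMod n) := by
      rintro rfl
      rw [ord_eq_of_eq_add hT rfl] at hlt
      omega
    have hv := h _ hlt
    rw [add_ord] at hv
    rw [remaining_insert hp h hlt.le]
    have hn : (∃ r ∈ insert p (remaining S i (ord n i v)), v ∈ supp n r) ↔
        ∃ r ∈ remaining S i (ord n i v), v ∈ supp n r := by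
      rw [← not_iff_not]
      push Not
      rw [← pickCW_eq_none_iff, ← pickCW_eq_none_iff, hv]
    rw [hn]
    simp [hne]
  · have hv : v = i + (T : ZMod n) := by rw [← heq, add_ord]
    simp only [hv, true_or, iff_true, ord_eq_of_eq_add hT rfl, remaining_insert hp h le_rfl]
    exact ⟨p, Finset.mem_insert_self _ _, hpT⟩
  · have hne : v ≠ i + (T : ZMod n) := by
      rintro rfl
      rw [ord_eq_of_eq_add hT rfl] at hgt
      omega
    obtain ⟨d, hd⟩ := Nat.exists_eq_add_of_le (show T + 1 ≤ ord n i v by omega)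
    rw [hd, hafter]
    simp [hne]

/-- If the run is over right after the first vertex of `p` has been processed, then `p`
contributes this vertex, to which no other propagator contributes. -/
lemma gnSet_insert_of_remaining_eq_empty {S : Finset (Prp n)} {p : Prp n} (hp : p ∉ S)
    {i : ZMod n} {T : ℕ} (hT : T < n) (h : ∀ s < T, i + (s : ZMod n) ∉ supp n p)
    (hpT : i + (T : ZMod n) ∈ supp n p) (hend : remaining (insert p S) i (T + 1) = ∅) :
    gnSet n (insert p S) i = insert (i + (T : ZMod n)) (gnSet n S i) ∧
      i + (T : ZMod n) ∉ gnSet n S i := by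
  have hpick : ∀ s < T, pickCW n (insert p (remaining S i s)) (i + (s : ZMod n)) =
      pickCW n (remaining S i s) (i + (s : ZMod n)) := fun s hs =>
    pickCW_insert_of_notMem_supp (h s hs)
  have hempty : remaining S i T = ∅ := by
    have hcard := card_le_card_stepCW_add_one (remaining (insert p S) i T) (i + (T : ZMod n))
    rw [← remaining_succ, hend, remaining_insert hp hpick le_rfl,
      Finset.card_insert_of_notMem fun h' => hp (remaining_subset _ _ _ h'),
      Finset.card_empty] at hcard
    exact Finset.card_eq_zero.1 (by omega)
  refine ⟨gnSet_insert hp hT hpick hpT (by simp [hempty]), ?_⟩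
  rw [mem_gnSet, ord_eq_of_eq_add hT rfl, hempty]
  simp

end Algorithm

section Hall

variable {n : ℕ}

lemma IsAdmissible.isWeaklyAdmissible {P : Finset (Prp n)} (hP : IsAdmissible n P) :
    IsWeaklyAdmissible n P := ⟨hP.dense, hP.noncross⟩

lemma IsWeaklyAdmissible.subset {P S : Finset (Prp n)} (hP : IsWeaklyAdmissible n P)
    (hS : S ⊆ P) : IsWeaklyAdmissible n S :=
  ⟨fun Q hQ => hP.dense Q (hQ.trans hS), fun p hp q hq => hP.noncross p (hS hp) q (hS hq)⟩

lemma IsWeaklyAdmissible.ends_not_adjacent {P : Finset (Prp n)} (hP : IsWeaklyAdmissible n P)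
    {a c : ZMod n} (h : s(a, c) ∈ P) : c ≠ a ∧ c ≠ a + 1 ∧ c + 1 ≠ a := by
  have hcard := hP.dense {s(a, c)} (by simpa using h) (Finset.singleton_nonempty _)
  rw [suppSet, Finset.singleton_biUnion, Finset.card_singleton] at hcard
  have hsub : ∀ x y z : ZMod n, ¬ supp n s(a, c) ⊆ {x, y, z} := fun x y z hs => by
    have := (Finset.card_le_card hs).trans Finset.card_le_three
    omega
  refine ⟨?_, ?_, ?_⟩
  · rintro rfl
    exact hsub c (c + 1) (c + 1) fun u hu => by simpa [supp, or_comm] using hu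
  · rintro rfl
    exact hsub a (a + 1) (a + 1 + 1) fun u hu => by simpa [supp] using hu
  · rintro rfl
    refine hsub c (c + 1) (c + 1 + 1) fun u hu => ?_
    simp only [supp, Sym2.lift_mk, Finset.mem_insert, Finset.mem_singleton] at hu ⊢
    tauto

lemma mem_suppSet {Q : Finset (Prp n)} {a : ZMod n} :
    a ∈ suppSet n Q ↔ ∃ r ∈ Q, a ∈ supp n r := by simp [suppSet]

variable [NeZero n]

/-- The clockwise-most propagator `x` at `v` has a far end `b` such that every other propagator
supported on `v` lies on the side of `x` between `v` and `b`. -/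
lemma IsWeaklyAdmissible.exists_farEnd {S : Finset (Prp n)} (hS : IsWeaklyAdmissible n S)
    {v : ZMod n} {x : Prp n} (hx : pickCW n S v = some x) :
    ∃ b : ZMod n, ord n v b + 1 < n ∧
      (∀ r ∈ S, r ≠ x → v ∈ supp n r → ∃ e ∈ r, ord n v e < ord n v b) ∧
      (∀ r ∈ S, r ≠ x → ∀ e f, r = s(e, f) → ord n v e < ord n v b →
        ord n v f ≤ ord n v b ∨ f = v - 1) ∧
      (∀ r ∈ S, r ≠ x → v ∈ supp n r → ∀ u ∈ supp n x,
        u ∈ supp n r ∨ u = v - 1 ∨ u = b ∨ u = b + 1) := by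
  obtain ⟨hxS, hxv, hmax⟩ := pickCW_eq_some hx
  have hvv : ord n v v = 0 := by simp [ord]
  have hpos : ∀ u, u ≠ v → 0 < ord n v u := fun u hu =>
    Nat.pos_of_ne_zero fun h => hu (ord_injective v (h.trans hvv.symm))
  by_cases hv : v - 1 ∈ x
  · obtain ⟨b, rfl⟩ := hv
    obtain ⟨hb1, hb2, -⟩ := hS.ends_not_adjacent hxS
    rw [sub_add_cancel] at hb2
    have hkey : cwKey n v s(v - 1, b) = n + ord n v b + 1 := by
      rw [cwKey_of_sub_one_mem (Sym2.mem_mk_left _ _), otherEnd_mk, ord_sub_one_of_ne hb1,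
        add_assoc]
    refine ⟨b, ord_add_one_lt_of_ne hb1, fun r hr hrx hrv => ?_, fun r hr hrx e f hef he => ?_,
      fun r hr hrx hrv u hu => ?_⟩
    · rcases mem_supp.1 hrv with h | ⟨c, rfl⟩
      · exact ⟨v, h, hvv ▸ hpos b hb2⟩
      · have hc := (hS.ends_not_adjacent hr).1
        have hle := hmax _ hr hrv
        rw [hkey, cwKey_of_sub_one_mem (Sym2.mem_mk_left _ _), otherEnd_mk,
          ord_sub_one_of_ne hc] at hle
        have hne : ord n v c ≠ ord n v b := fun h => hrx (by rw [ord_injective v h])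
        exact ⟨c, Sym2.mem_mk_right _ _, by omega⟩
    · by_contra! hcon
      obtain ⟨hfb, hf⟩ := hcon
      have he1 : e ≠ v - 1 := by
        rintro rfl
        have h1 := ord_sub_natCast v (k := 1) one_pos (NeZero.one_le)
        rw [Nat.cast_one] at h1
        have h2 := ord_lt v b
        omega
      refine hS.noncross _ hxS _ hr ⟨v - 1, b, e, f, rfl, hef, ?_⟩
      rw [ord_sub_one_of_ne he1, ord_sub_one_of_ne hb1, ord_sub_one_of_ne hf]
      omega
    · simp only [supp, Sym2.lift_mk, Finset.mem_insert, Finset.mem_singleton,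
        sub_add_cancel] at hu
      rcases hu with rfl | rfl | rfl | rfl <;> tauto
  · obtain ⟨b, rfl⟩ := (mem_supp.1 hxv).resolve_right hv
    obtain ⟨hb1, -, hb3⟩ := hS.ends_not_adjacent hxS
    have hkey : cwKey n v s(v, b) = ord n v b := by
      rw [cwKey_of_sub_one_notMem hv, otherEnd_mk]
    have hon : ∀ r ∈ S, v ∈ supp n r → v - 1 ∉ r := fun r hr hrv =>
      cwKey_lt_iff.1 ((hmax r hr hrv).trans_lt (cwKey_lt_iff.2 hv))
    refine ⟨b, ord_add_one_lt_of_ne fun h => hb3 (by rw [h, sub_add_cancel]),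
      fun r hr hrx hrv => ?_, fun r hr hrx e f hef he => Or.inl ?_, fun r hr hrx hrv u hu => ?_⟩
    · exact ⟨v, (mem_supp.1 hrv).resolve_right (hon r hr hrv), hvv ▸ hpos b hb1⟩
    · by_cases hev : e = v
      · subst hef hev
        have hrv : e ∈ supp n s(e, f) := mem_supp.2 (Or.inl (Sym2.mem_mk_left _ _))
        have hle := hmax _ hr hrv
        rwa [hkey, cwKey_of_sub_one_notMem (hon _ hr hrv), otherEnd_mk] at hle
      · by_contra! hcon
        exact hS.noncross _ hxS _ hr ⟨v, b, e, f, rfl, hef, hpos e hev, he, hcon⟩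
    · have hvr := (mem_supp.1 hrv).resolve_right (hon r hr hrv)
      simp only [supp, Sym2.lift_mk, Finset.mem_insert, Finset.mem_singleton] at hu
      rcases hu with rfl | rfl | rfl | rfl
      · exact Or.inl hrv
      · exact Or.inl (mem_supp.2 (Or.inr (by rwa [add_sub_cancel_right])))
      · tauto
      · tauto

lemma mem_cInterval {a x : ZMod n} {L : ℕ} : x ∈ cInterval n a L ↔ ord n a x < L := by
  simp [cInterval]

lemma mem_cInterval_succ {v u : ZMod n} {L : ℕ} (hu : u ≠ v) :
    u ∈ cInterval n v (L + 1) ↔ u ∈ cInterval n (v + 1) L := by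
  rw [mem_cInterval, mem_cInterval, ord_add_one_of_ne hu, Nat.add_lt_add_iff_right]

/-- In a set of propagators satisfying Hall's condition on an interval starting at `v`, a set
of propagators supported on `v` and not containing the clockwise-most one has surplus. -/
lemma IsWeaklyAdmissible.card_lt_of_mem_suppSet {S : Finset (Prp n)}
    (hS : IsWeaklyAdmissible n S) {v : ZMod n} {x : Prp n} (hx : pickCW n S v = some x) {M : ℕ}
    (hM : M < n)
    (hall : ∀ Q ⊆ S, Q.card ≤ (suppSet n Q ∩ cInterval n v M).card)
    {Q : Finset (Prp n)} (hQ : Q ⊆ S.erase x) (hvQ : v ∈ suppSet n Q) :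
    Q.card < (suppSet n Q ∩ cInterval n v M).card := by
  obtain ⟨b, hb, hnear, hinside, hcover⟩ := hS.exists_farEnd hx
  have hxS := (pickCW_eq_some hx).1
  have hmemS : ∀ r ∈ Q, r ∈ S := fun r hr => Finset.mem_of_mem_erase (hQ hr)
  have hne : ∀ r ∈ Q, r ≠ x := fun r hr => Finset.ne_of_mem_erase (hQ hr)
  have hxQ : ∀ Q' ⊆ Q, x ∉ Q' := fun Q' h h' => hne x (h h') rfl
  have hv1 : ord n v (v - 1) + 1 = n := by
    have h := ord_sub_natCast v (k := 1) one_pos NeZero.one_le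
    rw [Nat.cast_one] at h
    omega
  have hb1 : ord n v (b + 1) = ord n v b + 1 := by
    refine ord_eq_of_eq_add (by omega) ?_
    rw [Nat.cast_add, Nat.cast_one, ← add_assoc, add_ord]
  obtain ⟨y, hy, hyv⟩ := mem_suppSet.1 hvQ
  rcases le_or_gt M (ord n v b) with hbM | hbM
  · have h := hall (insert x Q) (Finset.insert_subset hxS hmemS)
    rw [Finset.card_insert_of_notMem (hxQ Q subset_rfl)] at h
    refine Nat.lt_of_succ_le (h.trans (Finset.card_le_card fun u hu => ?_))
    rw [Finset.mem_inter, mem_cInterval] at hu ⊢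
    refine ⟨?_, hu.2⟩
    obtain ⟨r, hr, hur⟩ := mem_suppSet.1 hu.1
    rcases Finset.mem_insert.1 hr with rfl | hr
    · rcases hcover y (hmemS y hy) (hne y hy) hyv u hur with h | rfl | rfl | rfl
      · exact mem_suppSet.2 ⟨y, hy, h⟩
      all_goals omega
    · exact mem_suppSet.2 ⟨r, hr, hur⟩
  · set I := Q.filter fun r => ∃ e ∈ r, ord n v e < ord n v b
    set O := Q.filter fun r => ¬ ∃ e ∈ r, ord n v e < ord n v b
    have hsplit : I.card + O.card = Q.card := Finset.card_filter_add_card_filter_not _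
    have hIQ : I ⊆ Q := Finset.filter_subset _ _
    have hOQ : O ⊆ Q := Finset.filter_subset _ _
    have hyI : y ∈ I :=
      Finset.mem_filter.2 ⟨hy, hnear y (hmemS y hy) (hne y hy) hyv⟩
    set F := cInterval n v M
    set A := suppSet n I ∩ F
    set B := suppSet n O ∩ F
    set E : Finset (ZMod n) := {b, b + 1}
    have hvO : v ∉ suppSet n O := fun h => by
      obtain ⟨r, hr, hrv⟩ := mem_suppSet.1 h
      have hr' := Finset.mem_filter.1 hr
      exact hr'.2 (hnear r (hmemS r hr'.1) (hne r hr'.1) hrv)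
    have hIpos : ∀ u ∈ suppSet n I, ord n v u ≤ ord n v b ∨ u = v - 1 ∨ u = b + 1 := by
      intro u hu
      obtain ⟨r, hr, hur⟩ := mem_suppSet.1 hu
      obtain ⟨hrQ, e, ⟨f, rfl⟩, he⟩ := Finset.mem_filter.1 hr
      have hend : ∀ g ∈ s(e, f), ord n v g ≤ ord n v b ∨ g = v - 1 := by
        intro g hg
        rcases Sym2.mem_iff.1 hg with rfl | rfl
        · exact Or.inl he.le
        · exact hinside _ (hmemS _ hrQ) (hne _ hrQ) e g rfl he
      rcases mem_supp.1 hur with h | h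
      · rcases hend u h with h | h <;> tauto
      · rcases hend _ h with h | h
        · rcases eq_or_ne u v with rfl | huv
          · simp [ord]
          · have h1 := ord_add_one_of_ne (v := v - 1) (x := u - 1) (by simpa using huv)
            have hsub : ord n (v - 1) (u - 1) = ord n v u := by simp [ord]
            rw [sub_add_cancel, hsub] at h1
            rcases Nat.lt_or_ge (ord n v b) (ord n v u) with hlt | hge
            · refine Or.inr (Or.inr (ord_injective v ?_))
              omega
            · exact Or.inl hge
        · rw [sub_left_inj] at h
          subst h
          simp [ord]
    have hOpos : ∀ u ∈ suppSet n O, ord n v b ≤ ord n v u := by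
      intro u hu
      have huv : u ≠ v := fun h => hvO (h ▸ hu)
      obtain ⟨r, hr, hur⟩ := mem_suppSet.1 hu
      obtain ⟨hrQ, hrO⟩ := Finset.mem_filter.1 hr
      push Not at hrO
      rcases mem_supp.1 hur with h | h
      · exact hrO u h
      · have h1 := ord_add_one_of_ne (v := v - 1) (x := u - 1) (by simpa using huv)
        have hsub : ord n (v - 1) (u - 1) = ord n v u := by simp [ord]
        rw [sub_add_cancel, hsub] at h1
        have := hrO _ h
        omega
    have hAB : A ∩ B ⊆ A ∩ E := by
      intro u hu
      simp only [A, B, E, Finset.mem_inter, Finset.mem_insert, Finset.mem_singleton] at hu ⊢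
      refine ⟨hu.1, ?_⟩
      rcases hIpos u hu.1.1 with h | rfl | h
      · exact Or.inl (ord_injective v (le_antisymm h (hOpos u hu.2.1)))
      · have := mem_cInterval.1 hu.1.2
        omega
      · exact Or.inr h
    have hcardAE : I.card + 3 ≤ (A ∪ E).card := by
      have hd := hS.dense (insert x I) (Finset.insert_subset hxS fun r hr => hmemS r (hIQ hr))
        (Finset.insert_nonempty _ _)
      rw [Finset.card_insert_of_notMem (hxQ I hIQ)] at hd
      have hsub : suppSet n (insert x I) ⊆ insert (v - 1) (A ∪ E) := by
        have hIsub : suppSet n I ⊆ insert (v - 1) (A ∪ E) := by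
          intro u hu
          simp only [A, E, F, Finset.mem_insert, Finset.mem_union, Finset.mem_inter,
            Finset.mem_singleton, mem_cInterval]
          rcases hIpos u hu with h | h | h
          · exact Or.inr (Or.inl ⟨hu, by omega⟩)
          · exact Or.inl h
          · exact Or.inr (Or.inr (Or.inr h))
        intro u hu
        obtain ⟨r, hr, hur⟩ := mem_suppSet.1 hu
        rcases Finset.mem_insert.1 hr with rfl | hr
        · rcases hcover y (hmemS y hy) (hne y hy) hyv u hur with h | h | h | h
          · exact hIsub (mem_suppSet.2 ⟨y, hyI, h⟩)
          · simp [h]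
          · simp [E, h]
          · simp [E, h]
        · exact hIsub (mem_suppSet.2 ⟨r, hr, hur⟩)
      have h1 := Finset.card_le_card hsub
      have h2 := Finset.card_insert_le (v - 1) (A ∪ E)
      omega
    have hQAB : suppSet n Q ∩ F = A ∪ B := by
      have hunion : suppSet n Q = suppSet n I ∪ suppSet n O := by
        rw [suppSet, suppSet, suppSet, ← Finset.union_biUnion,
          Finset.filter_union_filter_not_eq]
      rw [hunion, Finset.union_inter_distrib_right]
    have hB : O.card ≤ B.card := hall O fun r hr => hmemS r (hOQ hr)
    have hE : E.card ≤ 2 := Finset.card_le_two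
    have hAE := Finset.card_union_add_card_inter A E
    have hABc := Finset.card_union_add_card_inter A B
    have hle := Finset.card_le_card hAB
    rw [hQAB]
    omega

/-- If Hall's condition holds on the interval of length `L` starting at `v`, then the algorithm
started at `v` deletes every propagator within its first `L` steps. -/
lemma IsWeaklyAdmissible.remaining_eq_empty {S : Finset (Prp n)} (hS : IsWeaklyAdmissible n S)
    {v : ZMod n} {L : ℕ} (hL : L < n)
    (hall : ∀ Q ⊆ S, Q.card ≤ (suppSet n Q ∩ cInterval n v L).card) :
    remaining S v L = ∅ := by
  induction L generalizing S v with
  | zero =>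
    have h := hall S subset_rfl
    have h0 : cInterval n v 0 = ∅ := by ext u; simp [mem_cInterval]
    rw [h0, Finset.inter_empty, Finset.card_empty] at h
    exact Finset.card_eq_zero.1 (Nat.le_zero.1 h)
  | succ L ih =>
    have hstep : ∀ Q ⊆ S, v ∉ suppSet n Q →
        Q.card ≤ (suppSet n Q ∩ cInterval n (v + 1) L).card := fun Q hQ hv => by
      refine (hall Q hQ).trans (Finset.card_le_card fun u hu => ?_)
      rw [Finset.mem_inter] at hu ⊢
      exact ⟨hu.1, (mem_cInterval_succ (by rintro rfl; exact hv hu.1)).1 hu.2⟩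
    rw [remaining_succ']
    refine ih (hS.subset (stepCW_subset S v)) (by omega) fun Q hQ => ?_
    by_cases hv : v ∈ suppSet n Q
    · cases h : pickCW n S v with
      | none =>
        obtain ⟨r, hr, hrv⟩ := mem_suppSet.1 hv
        exact absurd hrv (pickCW_eq_none_iff.1 h r (stepCW_subset S v (hQ hr)))
      | some x =>
        rw [stepCW_of_some h] at hQ
        have hlt := hS.card_lt_of_mem_suppSet h hL hall hQ hv
        have hsub : suppSet n Q ∩ cInterval n v (L + 1) ⊆
            insert v (suppSet n Q ∩ cInterval n (v + 1) L) := fun u hu => by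
          rw [Finset.mem_inter] at hu
          rw [Finset.mem_insert, Finset.mem_inter]
          by_cases huv : u = v
          · exact Or.inl huv
          · exact Or.inr ⟨hu.1, (mem_cInterval_succ huv).1 hu.2⟩
        have h1 := Finset.card_le_card hsub
        have h2 := Finset.card_insert_le v (suppSet n Q ∩ cInterval n (v + 1) L)
        omega
    · exact hstep Q (hQ.trans (stepCW_subset S v)) hv

end Hall

section GoodPropagator

variable {n : ℕ}

lemma mem_supp_good {u : ZMod n} :
    u ∈ supp n (s(-3, -1) : Prp n) ↔ u = -3 ∨ u = -2 ∨ u = -1 ∨ u = 0 := by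
  rw [mem_supp, Sym2.mem_iff, Sym2.mem_iff, sub_eq_iff_eq_add, sub_eq_iff_eq_add,
    show (-3 : ZMod n) + 1 = -2 by ring, neg_add_cancel]
  tauto

lemma ord_neg_one_neg_three (hn : 5 ≤ n) : ord n (-1) (-3) = n - 2 := by
  have h := ord_sub_natCast (-1 : ZMod n) (k := 2) two_pos (by omega)
  rwa [Nat.cast_ofNat, show (-1 : ZMod n) - 2 = -3 by ring] at h

lemma otherEnd_good_neg_one : otherEnd n (s(-3, -1) : Prp n) (-1) = -3 := by
  rw [Sym2.eq_swap, otherEnd_mk]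

variable [NeZero n]

lemma IsWeaklyAdmissible.add_one_notMem {P : Finset (Prp n)} (hP : IsWeaklyAdmissible n P)
    (hn : 2 < n) {a : ZMod n} (ha : s(a, a + 2) ∈ P) {r : Prp n} (hr : r ∈ P) : a + 1 ∉ r := by
  rintro ⟨l, rfl⟩
  obtain ⟨h1, h2, h3⟩ := hP.ends_not_adjacent hr
  have ho1 : ord n a (a + 1) = 1 := ord_eq_of_eq_add (by omega) (by simp)
  have ho2 : ord n a (a + 2) = 2 := ord_eq_of_eq_add hn (by simp)
  have hl := add_ord a l
  refine hP.noncross _ ha _ hr ⟨a, a + 2, a + 1, l, rfl, rfl, by omega, by omega, ?_⟩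
  rw [ho2]
  by_contra! hle
  interval_cases h : ord n a l
  · exact h3 (by rw [← hl]; simp)
  · exact h1 (by rw [← hl]; simp)
  · exact h2 (by rw [← hl]; push_cast; ring)

variable {P : Finset (Prp n)}

lemma IsWeaklyAdmissible.neg_two_notMem (hP : IsWeaklyAdmissible n P) (hn : 5 ≤ n)
    (hp : (s(-3, -1) : Prp n) ∈ P) {r : Prp n} (hr : r ∈ P) : (-2 : ZMod n) ∉ r := by
  have h := hP.add_one_notMem (by omega) (a := -3)
    (by rwa [show (-3 : ZMod n) + 2 = -1 by ring]) hr
  rwa [show (-3 : ZMod n) + 1 = -2 by ring] at h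

lemma IsWeaklyAdmissible.pickCW_neg_one (hP : IsWeaklyAdmissible n P) (hn : 5 ≤ n)
    (hp : (s(-3, -1) : Prp n) ∈ P) : pickCW n P (-1) = some s(-3, -1) := by
  have h2 : (-1 : ZMod n) - 1 = -2 := by ring
  refine pickCW_eq_some_iff.2 ⟨hp, mem_supp_good.2 (by tauto), fun r hr ha => ?_⟩
  have hr2 := hP.neg_two_notMem hn hp hr
  have hp2 := hP.neg_two_notMem hn hp hp
  rw [mem_supp, h2, or_iff_left hr2] at ha
  obtain ⟨c, rfl⟩ := ha
  rw [← h2] at hr2 hp2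
  rw [cwKey_of_sub_one_notMem hp2, cwKey_of_sub_one_notMem hr2, otherEnd_good_neg_one,
    otherEnd_mk, ord_neg_one_neg_three hn]
  have := ord_add_one_lt_of_ne (v := -1) (x := c) (by
    rintro rfl
    exact hr2 (Sym2.mem_mk_right _ _))
  omega

lemma IsWeaklyAdmissible.pickCW_zero (hP : IsWeaklyAdmissible n P) (hn : 5 ≤ n)
    (hp : (s(-3, -1) : Prp n) ∈ P) : pickCW n P 0 = some s(-3, -1) := by
  refine pickCW_eq_some_iff.2 ⟨hp, mem_supp_good.2 (by tauto), fun r hr ha => ?_⟩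
  rw [cwKey_of_sub_one_mem (p := s(-3, -1)) (by simp), zero_sub, otherEnd_good_neg_one,
    ord_neg_one_neg_three hn]
  by_cases hr1 : (0 : ZMod n) - 1 ∈ r
  · obtain ⟨c, rfl⟩ := hr1
    rw [cwKey_of_sub_one_mem (Sym2.mem_mk_left _ _), otherEnd_mk]
    have := ord_add_one_lt_of_ne (v := (0 : ZMod n) - 1) (x := c) (by
      rintro rfl
      refine hP.neg_two_notMem hn hp hr ?_
      rw [show (0 : ZMod n) - 1 - 1 = -2 by ring]
      exact Sym2.mem_mk_right _ _)
    omega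
  · have := cwKey_lt_iff.2 hr1
    omega

lemma card_le_card_inter_cInterval {Q : Finset (Prp n)} {i : ZMod n} {L k : ℕ}
    {U X : Finset (ZMod n)} (hX : X.card ≤ k) (hU : k + Q.card ≤ U.card)
    (hsub : ∀ u ∈ U, u ∉ X → u ∈ suppSet n Q ∧ ord n i u < L) :
    Q.card ≤ (suppSet n Q ∩ cInterval n i L).card := by
  have h1 : U ⊆ (suppSet n Q ∩ cInterval n i L) ∪ X := fun u hu => by
    by_cases huX : u ∈ X
    · exact Finset.mem_union_right _ huX
    · exact Finset.mem_union_left _ (Finset.mem_inter.2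
        ⟨(hsub u hu huX).1, mem_cInterval.2 (hsub u hu huX).2⟩)
  have h2 := (Finset.card_le_card h1).trans (Finset.card_union_le _ _)
  omega

lemma IsWeaklyAdmissible.remaining_one_eq_empty (hP : IsWeaklyAdmissible n P) (hn : 3 ≤ n) :
    remaining P 1 (n - 3) = ∅ := by
  refine hP.remaining_eq_empty (by omega) fun Q hQ => ?_
  rcases Q.eq_empty_or_nonempty with rfl | hne
  · simp
  refine card_le_card_inter_cInterval (X := {-2, -1, 0}) Finset.card_le_three
    ((add_comm _ _).trans_le (hP.dense Q hQ hne)) fun u hu huX => ⟨hu, ?_⟩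
  simp only [Finset.mem_insert, Finset.mem_singleton] at huX
  by_contra! hle
  refine huX ?_
  have hlt := ord_lt 1 u
  obtain h | h | h : ord n 1 u + 3 = n ∨ ord n 1 u + 2 = n ∨ ord n 1 u + 1 = n := by omega
  all_goals
    have := eq_of_ord_add_eq (by omega) h
    norm_num at this
    tauto

lemma IsWeaklyAdmissible.remaining_erase_zero_eq_empty (hP : IsWeaklyAdmissible n P)
    (hn : 5 ≤ n) (hp : (s(-3, -1) : Prp n) ∈ P) :
    remaining (P.erase (s(-3, -1) : Prp n)) 0 (n - 4) = ∅ := by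
  have hlast : ∀ u : ZMod n, u ≠ -4 → u ≠ -3 → u ≠ -2 → u ≠ -1 → ord n 0 u < n - 4 := by
    intro u h4 h3 h2 h1
    by_contra! hle
    have hlt := ord_lt 0 u
    obtain h | h | h | h : ord n 0 u + 4 = n ∨ ord n 0 u + 3 = n ∨ ord n 0 u + 2 = n ∨
      ord n 0 u + 1 = n := by omega
    all_goals
      have := eq_of_ord_add_eq (by omega) h
      norm_num at this
      tauto
  refine (hP.subset (Finset.erase_subset _ _)).remaining_eq_empty (by omega) fun Q hQ => ?_
  rcases Q.eq_empty_or_nonempty with rfl | hne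
  · simp
  have hQP : Q ⊆ P := hQ.trans (Finset.erase_subset _ _)
  by_cases h0 : (0 : ZMod n) ∈ suppSet n Q
  · have hd := hP.dense (insert s(-3, -1) Q) (Finset.insert_subset hp hQP)
      (Finset.insert_nonempty _ _)
    rw [Finset.card_insert_of_notMem fun h => Finset.ne_of_mem_erase (hQ h) rfl] at hd
    refine card_le_card_inter_cInterval (U := suppSet n (insert s(-3, -1) Q))
      (X := {-4, -3, -2, -1}) (k := 4) Finset.card_le_four (by omega) fun u hu huX => ?_
    simp only [Finset.mem_insert, Finset.mem_singleton, not_or] at huX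
    refine ⟨?_, hlast u huX.1 huX.2.1 huX.2.2.1 huX.2.2.2⟩
    obtain ⟨r, hr, hur⟩ := mem_suppSet.1 hu
    rcases Finset.mem_insert.1 hr with rfl | hr
    · rcases mem_supp_good.1 hur with h | h | h | rfl
      · tauto
      · tauto
      · tauto
      · exact h0
    · exact mem_suppSet.2 ⟨r, hr, hur⟩
  · refine card_le_card_inter_cInterval (X := {-4, -3, -2}) Finset.card_le_three
      ((add_comm _ _).trans_le (hP.dense Q hQP hne)) fun u hu huX => ⟨hu, ?_⟩
    simp only [Finset.mem_insert, Finset.mem_singleton, not_or] at huX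
    refine hlast u huX.1 huX.2.1 huX.2.2 ?_
    rintro rfl
    obtain ⟨r, hr, hur⟩ := mem_suppSet.1 hu
    rcases mem_supp.1 hur with h | h
    · exact h0 (mem_suppSet.2 ⟨r, hr, mem_supp.2 (Or.inr (by rwa [zero_sub]))⟩)
    · rw [show (-1 : ZMod n) - 1 = -2 by ring] at h
      exact hP.neg_two_notMem hn hp (hQP hr) h

end GoodPropagator

section Necklace

variable {n : ℕ}

lemma le_ord_one_of_mem_supp_good (hn : 5 ≤ n) {u : ZMod n}
    (hu : u ∈ supp n (s(-3, -1) : Prp n)) : n - 4 ≤ ord n 1 u := by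
  have h4 := ord_sub_natCast (1 : ZMod n) (k := 4) (by omega) (by omega)
  have h3 := ord_sub_natCast (1 : ZMod n) (k := 3) (by omega) (by omega)
  have h2 := ord_sub_natCast (1 : ZMod n) (k := 2) (by omega) (by omega)
  have h1 := ord_sub_natCast (1 : ZMod n) (k := 1) (by omega) (by omega)
  norm_num at h4 h3 h2 h1
  rcases mem_supp_good.1 hu with rfl | rfl | rfl | rfl <;> omega

lemma neg_four_notMem_good (hn : 5 ≤ n) : (-4 : ZMod n) ∉ (s(-3, -1) : Prp n) := fun h => by
  have h1 := le_ord_one_of_mem_supp_good hn (mem_supp.2 (Or.inl h))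
  have h5 := ord_sub_natCast (1 : ZMod n) (k := 5) (by omega) hn
  norm_num at h5
  omega

lemma le_ord_zero_of_mem_supp (hn : 5 ≤ n) {u : ZMod n}
    (hu : u ∈ supp n (s(-5, -3) : Prp n)) : n - 5 ≤ ord n 0 u := by
  have h5 := ord_sub_natCast (0 : ZMod n) (k := 5) (by omega) (by omega)
  have h4 := ord_sub_natCast (0 : ZMod n) (k := 4) (by omega) (by omega)
  have h3 := ord_sub_natCast (0 : ZMod n) (k := 3) (by omega) (by omega)
  have h2 := ord_sub_natCast (0 : ZMod n) (k := 2) (by omega) (by omega)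
  norm_num at h5 h4 h3 h2
  rw [mem_supp, Sym2.mem_iff, Sym2.mem_iff, sub_eq_iff_eq_add, sub_eq_iff_eq_add] at hu
  norm_num at hu
  rcases hu with (rfl | rfl) | rfl | rfl <;> omega

lemma ord_neg_three_neg_one (hn : 5 ≤ n) : ord n (-3) (-1) = 2 :=
  ord_eq_of_eq_add (by omega) (by push_cast; ring)

lemma ord_neg_three_neg_five (hn : 5 ≤ n) : ord n (-3) (-5) = n - 2 := by
  have h := ord_sub_natCast (-3 : ZMod n) (k := 2) two_pos (by omega)
  rwa [Nat.cast_ofNat, show (-3 : ZMod n) - 2 = -5 by ring] at h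

lemma otherEnd_neg_five_neg_three : otherEnd n (s(-5, -3) : Prp n) (-3) = -5 := by
  rw [Sym2.eq_swap, otherEnd_mk]

lemma cwKey_neg_two_good_lt (hn : 5 ≤ n) :
    cwKey n (-2) (s(-3, -1) : Prp n) < cwKey n (-2) (s(-5, -3) : Prp n) := by
  have h3 : (-2 : ZMod n) - 1 = -3 := by ring
  rw [cwKey_of_sub_one_mem (by simp [h3]), cwKey_of_sub_one_mem (by simp [h3]), h3, otherEnd_mk,
    otherEnd_neg_five_neg_three, ord_neg_three_neg_one hn, ord_neg_three_neg_five hn]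
  omega

variable [NeZero n] {P : Finset (Prp n)}

/-- The edge `-3` carries no propagator of `P` besides `(-3, -1)` and `(-5, -3)`, and in the
second case the edge `-4` carries none. -/
def NegThreeEdge (P : Finset (Prp n)) : Prop :=
  ∀ r ∈ P, (-3 : ZMod n) ∈ r →
    r = (s(-3, -1) : Prp n) ∨ r = (s(-5, -3) : Prp n) ∧ ∀ r' ∈ P, (-4 : ZMod n) ∉ r'

lemma NegThreeEdge.cwKey_neg_three_good_lt (hE : NegThreeEdge P) (hn : 5 ≤ n) {z : Prp n}
    (hz : z ∈ P.erase (s(-3, -1) : Prp n)) (hz3 : (-3 : ZMod n) ∈ supp n z) :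
    cwKey n (-3) (s(-3, -1) : Prp n) < cwKey n (-3) z := by
  have h4 : (-3 : ZMod n) - 1 = -4 := by ring
  obtain ⟨hzp, hz⟩ := Finset.mem_erase.1 hz
  rw [cwKey_of_sub_one_notMem (p := s(-3, -1)) (by rw [h4]; exact neg_four_notMem_good hn),
    otherEnd_mk, ord_neg_three_neg_one hn]
  by_cases hz4 : (-3 : ZMod n) - 1 ∈ z
  · have := cwKey_lt_iff.not_left.2 hz4
    omega
  · obtain rfl := ((hE z hz ((mem_supp.1 hz3).resolve_right hz4)).resolve_left hzp).1
    rw [cwKey_of_sub_one_notMem hz4, otherEnd_neg_five_neg_three, ord_neg_three_neg_five hn]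
    omega

lemma IsWeaklyAdmissible.eq_of_neg_two_mem_supp (hP : IsWeaklyAdmissible n P) (hn : 5 ≤ n)
    (hp : (s(-3, -1) : Prp n) ∈ P) (hE : NegThreeEdge P) {r : Prp n}
    (hr : r ∈ P.erase (s(-3, -1) : Prp n)) (hr2 : (-2 : ZMod n) ∈ supp n r) :
    r = s(-5, -3) ∧ ∀ r' ∈ P, (-4 : ZMod n) ∉ r' := by
  obtain ⟨hrp, hr⟩ := Finset.mem_erase.1 hr
  have h3 := (mem_supp.1 hr2).resolve_left (hP.neg_two_notMem hn hp hr)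
  rw [show (-2 : ZMod n) - 1 = -3 by ring] at h3
  exact (hE r hr h3).resolve_left hrp

lemma IsWeaklyAdmissible.gnSet_one (hP : IsWeaklyAdmissible n P) (hn : 5 ≤ n)
    (hp : (s(-3, -1) : Prp n) ∈ P) :
    gnSet n P 1 = insert (-3) (gnSet n (P.erase (s(-3, -1) : Prp n)) 1) := by
  have hT : (1 : ZMod n) + ((n - 4 : ℕ) : ZMod n) = -3 := by
    rw [Nat.cast_sub (by omega), ZMod.natCast_self]
    push_cast
    ring
  have h := gnSet_insert_of_remaining_eq_empty (Finset.notMem_erase (s(-3, -1) : Prp n) P)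
    (i := 1) (T := n - 4) (by omega) (fun s hs hmem => ?_) (by simp [hT, mem_supp_good])
    (by
      rw [Finset.insert_erase hp, show n - 4 + 1 = n - 3 by omega]
      exact hP.remaining_one_eq_empty (by omega))
  · rw [Finset.insert_erase hp, hT] at h
    exact h.1
  · have := le_ord_one_of_mem_supp_good hn hmem
    rw [ord_eq_of_eq_add (k := s) (by omega) rfl] at this
    omega

lemma IsWeaklyAdmissible.gnSet_zero (hP : IsWeaklyAdmissible n P) (hn : 5 ≤ n)
    (hp : (s(-3, -1) : Prp n) ∈ P) :
    gnSet n P 0 = insert 0 (gnSet n (P.erase (s(-3, -1) : Prp n)) 1) := by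
  rw [gnSet_of_pickCW_eq_some (hP.pickCW_zero hn hp), zero_add]

lemma IsWeaklyAdmissible.gnSet_neg_one (hP : IsWeaklyAdmissible n P) (hn : 5 ≤ n)
    (hp : (s(-3, -1) : Prp n) ∈ P) :
    gnSet n P (-1) = insert (-1) (gnSet n (P.erase (s(-3, -1) : Prp n)) 0) := by
  rw [gnSet_of_pickCW_eq_some (hP.pickCW_neg_one hn hp), neg_add_cancel]

lemma gnSet_neg_two_of_notMem (hp : (s(-3, -1) : Prp n) ∈ P)
    (h2 : (-2 : ZMod n) ∉ gnSet n (P.erase (s(-3, -1) : Prp n)) (-2)) :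
    gnSet n P (-2) = insert (-2) (gnSet n (P.erase (s(-3, -1) : Prp n)) (-2)) := by
  have hord : ord n (-2) (-2) = 0 := by simp [ord]
  have h := gnSet_insert (Finset.notMem_erase (s(-3, -1) : Prp n) P) (i := -2) (T := 0)
    (NeZero.pos n) (by simp) (by simp [mem_supp_good]) (fun r hr hmem => h2 (mem_gnSet.2 ⟨r, by
      rwa [hord], by simpa using hmem⟩))
  simpa only [Finset.insert_erase hp, Nat.cast_zero, add_zero] using h

lemma IsWeaklyAdmissible.mem_of_neg_two_mem_gnSet (hP : IsWeaklyAdmissible n P) (hn : 5 ≤ n)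
    (hp : (s(-3, -1) : Prp n) ∈ P) (hE : NegThreeEdge P)
    (h2 : (-2 : ZMod n) ∈ gnSet n (P.erase (s(-3, -1) : Prp n)) (-2)) :
    (s(-5, -3) : Prp n) ∈ P.erase (s(-3, -1) : Prp n) ∧
      (-2 : ZMod n) ∈ supp n (s(-5, -3) : Prp n) := by
  obtain ⟨r, hr, hr2⟩ := mem_gnSet.1 h2
  have hrV := remaining_subset _ _ _ hr
  obtain rfl := (hP.eq_of_neg_two_mem_supp hn hp hE hrV hr2).1
  exact ⟨hrV, hr2⟩

lemma IsWeaklyAdmissible.gnSet_neg_two_of_mem_of_notMem (hP : IsWeaklyAdmissible n P)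
    (hn : 5 ≤ n) (hp : (s(-3, -1) : Prp n) ∈ P) (hE : NegThreeEdge P)
    (h2 : (-2 : ZMod n) ∈ gnSet n (P.erase (s(-3, -1) : Prp n)) (-2))
    (h1 : (-1 : ZMod n) ∉ gnSet n (P.erase (s(-3, -1) : Prp n)) (-2)) :
    gnSet n P (-2) = insert (-1) (gnSet n (P.erase (s(-3, -1) : Prp n)) (-2)) := by
  obtain ⟨hq, hq2⟩ := hP.mem_of_neg_two_mem_gnSet hn hp hE h2
  have hT : (-2 : ZMod n) + ((1 : ℕ) : ZMod n) = -1 := by push_cast; ring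
  have hord : ord n (-2) (-1) = 1 := ord_eq_of_eq_add (by omega) hT.symm
  have h := gnSet_insert (Finset.notMem_erase (s(-3, -1) : Prp n) P) (i := -2) (T := 1)
    (by omega)
    (fun s hs => by
      obtain rfl : s = 0 := by omega
      rw [Nat.cast_zero, add_zero]
      exact pickCW_insert_of_lt hq hq2 (cwKey_neg_two_good_lt hn))
    (by rw [hT, mem_supp_good]; tauto)
    (fun r hr hmem => h1 (mem_gnSet.2 ⟨r, by rwa [hord], by rwa [← hT]⟩))
  rwa [Finset.insert_erase hp, hT] at h

lemma IsWeaklyAdmissible.gnSet_neg_two_of_mem (hP : IsWeaklyAdmissible n P)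
    (hn : 5 ≤ n) (hp : (s(-3, -1) : Prp n) ∈ P) (hE : NegThreeEdge P)
    (h2 : (-2 : ZMod n) ∈ gnSet n (P.erase (s(-3, -1) : Prp n)) (-2)) :
    gnSet n P (-2) =
      insert (-1) (insert (-2) ((gnSet n (P.erase (s(-3, -1) : Prp n)) 0).erase (-5))) := by
  obtain ⟨hq, hq2⟩ := hP.mem_of_neg_two_mem_gnSet hn hp hE h2
  obtain ⟨hqp, hqP⟩ := Finset.mem_erase.1 hq
  have hpick : pickCW n P (-2) = some s(-5, -3) :=
    pickCW_eq_some_iff.2 ⟨hqP, hq2, fun r hr hr2 => by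
      by_cases hrp : r = s(-3, -1)
      · rw [hrp]
        exact (cwKey_neg_two_good_lt hn).le
      · rw [(hP.eq_of_neg_two_mem_supp hn hp hE (Finset.mem_erase.2 ⟨hrp, hr⟩) hr2).1]⟩
  have hT : (0 : ZMod n) + ((n - 5 : ℕ) : ZMod n) = -5 := by
    rw [Nat.cast_sub (by omega), ZMod.natCast_self]
    push_cast
    ring
  have h := gnSet_insert_of_remaining_eq_empty
    (Finset.notMem_erase (s(-5, -3) : Prp n) (P.erase (s(-3, -1) : Prp n)))
    (i := 0) (T := n - 5) (by omega)
    (fun s hs hmem => by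
      have := le_ord_zero_of_mem_supp hn hmem
      rw [ord_eq_of_eq_add (k := s) (by omega) rfl] at this
      omega)
    (by simp [hT, mem_supp])
    (by
      rw [Finset.insert_erase hq, show n - 5 + 1 = n - 4 by omega]
      exact hP.remaining_erase_zero_eq_empty hn hp)
  rw [Finset.insert_erase hq, hT] at h
  rw [h.1, Finset.erase_insert h.2, Finset.insert_comm, gnSet_of_pickCW_eq_some hpick,
    show (-2 : ZMod n) + 1 = -1 by ring,
    (hP.subset (Finset.erase_subset _ _)).gnSet_neg_one hn (Finset.mem_erase.2 ⟨hqp.symm, hp⟩),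
    Finset.erase_right_comm]

lemma add_natCast_eq_neg_three {m : ZMod n} (hm : ord n 1 m + 4 ≤ n) :
    m + ((n - 4 - ord n 1 m : ℕ) : ZMod n) = -3 := by
  rw [Nat.sub_sub, Nat.cast_sub (by omega), ZMod.natCast_self]
  have := add_ord 1 m
  push_cast
  linear_combination -this

lemma add_natCast_notMem_supp_good (hn : 5 ≤ n) {m : ZMod n} {s : ℕ}
    (hs : s < n - 4 - ord n 1 m) : m + (s : ZMod n) ∉ supp n (s(-3, -1) : Prp n) := fun h => by
  have h' := le_ord_one_of_mem_supp_good hn h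
  have hm := add_ord 1 m
  rw [ord_eq_of_eq_add (k := ord n 1 m + s) (by omega) (by
    push_cast
    linear_combination -hm)] at h'
  omega

lemma gnSet_of_neg_three_notMem (hn : 5 ≤ n) (hp : (s(-3, -1) : Prp n) ∈ P) {m : ZMod n}
    (hm : ord n 1 m + 4 ≤ n)
    (h3 : (-3 : ZMod n) ∉ gnSet n (P.erase (s(-3, -1) : Prp n)) m) :
    gnSet n P m = insert (-3) (gnSet n (P.erase (s(-3, -1) : Prp n)) m) := by
  have hT := add_natCast_eq_neg_three hm
  have hord := ord_eq_of_eq_add (by omega) hT.symm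
  have h := gnSet_insert (Finset.notMem_erase (s(-3, -1) : Prp n) P) (i := m)
    (T := n - 4 - ord n 1 m) (by omega)
    (fun s hs => pickCW_insert_of_notMem_supp (add_natCast_notMem_supp_good hn hs))
    (by rw [hT, mem_supp_good]; tauto)
    (fun r hr hmem => h3 (mem_gnSet.2 ⟨r, by rwa [hord], by rwa [← hT]⟩))
  rwa [Finset.insert_erase hp, hT] at h

lemma IsWeaklyAdmissible.gnSet_of_neg_three_mem (hP : IsWeaklyAdmissible n P) (hn : 5 ≤ n)
    (hp : (s(-3, -1) : Prp n) ∈ P) (hE : NegThreeEdge P) {m : ZMod n}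
    (hm : ord n 1 m + 4 ≤ n)
    (h3 : (-3 : ZMod n) ∈ gnSet n (P.erase (s(-3, -1) : Prp n)) m) :
    gnSet n P m = insert (-2) (gnSet n (P.erase (s(-3, -1) : Prp n)) m) := by
  have hT := add_natCast_eq_neg_three hm
  have hord := ord_eq_of_eq_add (by omega) hT.symm
  have hT' : m + ((n - 4 - ord n 1 m + 1 : ℕ) : ZMod n) = -2 := by
    push_cast
    linear_combination hT
  obtain ⟨z, hz, hz3⟩ := mem_gnSet.1 h3
  rw [hord] at hz
  have h := gnSet_insert (Finset.notMem_erase (s(-3, -1) : Prp n) P) (i := m)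
    (T := n - 4 - ord n 1 m + 1) (by omega)
    (fun s hs => by
      rcases Nat.lt_succ_iff_lt_or_eq.1 hs with hs | rfl
      · exact pickCW_insert_of_notMem_supp (add_natCast_notMem_supp_good hn hs)
      · rw [hT]
        exact pickCW_insert_of_lt hz hz3
          (hE.cwKey_neg_three_good_lt hn (remaining_subset _ _ _ hz) hz3))
    (by rw [hT', mem_supp_good]; tauto)
    (fun r hr hmem => by
      rw [hT'] at hmem
      obtain ⟨rfl, h4⟩ := hP.eq_of_neg_two_mem_supp hn hp hE (remaining_subset _ _ _ hr) hmem
      have hpick : pickCW n (remaining (P.erase (s(-3, -1) : Prp n)) m (n - 4 - ord n 1 m)) (-3) =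
          some s(-5, -3) := by
        have hr' := hr
        rw [remaining_succ] at hr'
        refine pickCW_eq_some_iff.2 ⟨stepCW_subset _ _ hr', by simp [mem_supp],
          fun r' hr' hr3 => ?_⟩
        obtain ⟨hrp, hrP⟩ := Finset.mem_erase.1 (remaining_subset _ _ _ hr')
        have h3' := (mem_supp.1 hr3).resolve_right (by
          rw [show (-3 : ZMod n) - 1 = -4 by ring]
          exact h4 _ hrP)
        rw [((hE r' hrP h3').resolve_left hrp).1]
      rw [remaining_succ, hT, stepCW_of_some hpick] at hr
      exact Finset.notMem_erase _ _ hr)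
  rwa [Finset.insert_erase hp, hT'] at h

end Necklace

/-- the Grassmann necklace of `W` in terms of that of `V`.
Under the Setup (`W` admissible with `k ≥ 1` propagators, `p = (n-3, n-1)` a
length-2 propagator with nothing else inside it, the edge `n-3` supporting
either only `p` or exactly one further length-2 propagator `q = (n-5, n-3)`
with nothing else inside it; `V = W - p`):
`I_1^W = I_1^V ∪ {n-3}`; `I_n^W = I_1^V ∪ {n}`; `I_{n-1}^W = I_n^V ∪ {n-1}`;
`I_{n-2}^W = I_{n-2}^V ∪ {n-2}` if `n-2 ∉ I_{n-2}^V`;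
`I_{n-2}^W = I_{n-2}^V ∪ {n-1}` if `n-2 ∈ I_{n-2}^V` and `n-1 ∉ I_{n-2}^V`;
`I_{n-2}^W = (I_n^V \ {n-5}) ∪ {n-1, n-2}` if `n-2, n-1 ∈ I_{n-2}^V`;
and for `1 < m < n-2`: `I_m^W = I_m^V ∪ {n-3}` if `n-3 ∉ I_m^V`, while
`I_m^W = I_m^V ∪ {n-2}` if `n-3 ∈ I_m^V`.
(Vertices: `n = 0`, `n-1 = -1`, … in `ZMod n`.) -/
theorem gnSet_of_erase_good_propagator
    (n : ℕ) [NeZero n] (P : Finset (Prp n))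
    (hadm : IsAdmissible n P) (hne : P.Nonempty)
    (hp : (s(-3, -1) : Prp n) ∈ P)
    (hlen : plength n (s(-3, -1) : Prp n) = 2)
    (hin : ∀ r ∈ P, InsideDir n (-3) (s(-3, -1) : Prp n) r → r = (s(-3, -1) : Prp n))
    (hedge : (∀ r ∈ P, (-3 : ZMod n) ∈ r → r = (s(-3, -1) : Prp n)) ∨
      ((s(-5, -3) : Prp n) ∈ P ∧ plength n (s(-5, -3) : Prp n) = 2 ∧
        (∀ r ∈ P, (-3 : ZMod n) ∈ r →
          r = (s(-3, -1) : Prp n) ∨ r = (s(-5, -3) : Prp n)) ∧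
        (∀ r ∈ P, InsideDir n (-5) (s(-5, -3) : Prp n) r → r = (s(-5, -3) : Prp n))))
    :
    gnSet n P 1 = insert (-3) (gnSet n (eraseP n P) 1) ∧
    gnSet n P 0 = insert 0 (gnSet n (eraseP n P) 1) ∧
    gnSet n P (-1) = insert (-1) (gnSet n (eraseP n P) 0) ∧
    ((-2 : ZMod n) ∉ gnSet n (eraseP n P) (-2) →
      gnSet n P (-2) = insert (-2) (gnSet n (eraseP n P) (-2))) ∧
    ((-2 : ZMod n) ∈ gnSet n (eraseP n P) (-2) →
      (-1 : ZMod n) ∉ gnSet n (eraseP n P) (-2) →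
      gnSet n P (-2) = insert (-1) (gnSet n (eraseP n P) (-2))) ∧
    ((-2 : ZMod n) ∈ gnSet n (eraseP n P) (-2) →
      (-1 : ZMod n) ∈ gnSet n (eraseP n P) (-2) →
      gnSet n P (-2) = insert (-1) (insert (-2) ((gnSet n (eraseP n P) 0).erase (-5)))) ∧
    (∀ m : ZMod n, m ≠ 1 → ord n 1 m < n - 3 →
      ((-3 : ZMod n) ∉ gnSet n (eraseP n P) m →
        gnSet n P m = insert (-3) (gnSet n (eraseP n P) m)) ∧
      ((-3 : ZMod n) ∈ gnSet n (eraseP n P) m →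
        gnSet n P m = insert (-2) (gnSet n (eraseP n P) m))) := by
  have hP : IsWeaklyAdmissible n P := hadm.isWeaklyAdmissible
  have hn : 5 ≤ n := by
    have h1 := hadm.card_add_four_le
    have h2 := hne.card_pos
    omega
  have hE : NegThreeEdge P := by
    intro r hr hr3
    rcases hedge with h | ⟨hq, -, h, -⟩
    · exact Or.inl (h r hr hr3)
    · refine (h r hr hr3).imp_right fun hrq => ⟨hrq, fun r' hr' h4 => ?_⟩
      refine hP.add_one_notMem (by omega) (a := -5) ?_ hr' ?_
      · rwa [show (-5 : ZMod n) + 2 = -3 by ring]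
      · rwa [show (-5 : ZMod n) + 1 = -4 by ring]
  exact ⟨hP.gnSet_one hn hp, hP.gnSet_zero hn hp, hP.gnSet_neg_one hn hp,
    gnSet_neg_two_of_notMem hp, hP.gnSet_neg_two_of_mem_of_notMem hn hp hE,
    fun h2 _ => hP.gnSet_neg_two_of_mem hn hp hE h2,
    fun m _ hm => ⟨gnSet_of_neg_three_notMem hn hp (by omega),
      hP.gnSet_of_neg_three_mem hn hp hE (by omega)⟩⟩

end WLD
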